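/- Let (𝒫, ℒ) be a linear space with dim(𝒫, ℒ) ≥ 3. Then every maximal related set ℳ ⊆ ℒ is either a star of lines or a coplanar maximal related set, i.e., the union of the lines of ℳ spans a plane ℰ with ℰ = x ∨ y for all distinct x, y ∈ ℳ. -/

import Mathlib

/-- A linear space: a point set `P` together with a set of lines (subsets of `P`),
each line having at least two points, and any two distinct points lying on
exactly one line. -/
structure LinearSpace (P : Type*) where
  lines : Set (Set P)
  two_points : ∀ l ∈ lines, ∃ A B : P, A ≠ B ∧ A ∈ l ∧ B ∈ l
  unique_line : ∀ A B : P, A ≠ B → ∃! l, l ∈ lines ∧ A ∈ l ∧ B ∈ l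

namespace LinearSpace

variable {P : Type*} (LS : LinearSpace P)

/-- A subspace: a subset containing, with any two of its distinct points,
the line joining them. -/
def IsSubspace (S : Set P) : Prop :=
  ∀ l ∈ LS.lines, ∀ A ∈ l, ∀ B ∈ l, A ≠ B → A ∈ S → B ∈ S → l ⊆ S

/-- The span of a subset: the intersection of all subspaces containing it. -/
def span (S : Set P) : Set P :=
  ⋂₀ {T | LS.IsSubspace T ∧ S ⊆ T}

/-- The dimension of a subset `S` (intended for subspaces):
`min {#X - 1 | X ⊆ S, span X = S}` as an extended natural number. -/
noncomputable def sdim (S : Set P) : ℕ∞ :=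
  sInf {d : ℕ∞ | ∃ X : Set P, X ⊆ S ∧ LS.span X = S ∧ d = X.encard - 1}

/-- The dimension of the linear space: `min {#X - 1 | span X = P}`. -/
noncomputable def dim : ℕ∞ := LS.sdim Set.univ

/-- A plane is a 2-dimensional subspace. -/
def IsPlane (E : Set P) : Prop := LS.IsSubspace E ∧ LS.sdim E = 2

/-- A generalized projective space: every plane is a generalized projective
plane, i.e. any two distinct lines contained in a common plane meet. -/
def IsGenProjSpace : Prop :=
  ∀ E : Set P, LS.IsPlane E →
    ∀ l ∈ LS.lines, ∀ m ∈ LS.lines, l ⊆ E → m ⊆ E → l ≠ m → (l ∩ m).Nonempty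

/-- A related set: a set of lines which pairwise meet. -/
def IsRelatedSet (N : Set (Set P)) : Prop :=
  N ⊆ LS.lines ∧ ∀ a ∈ N, ∀ b ∈ N, (a ∩ b).Nonempty

/-- A maximal related set: a related set maximal with respect to inclusion. -/
def IsMaxRelatedSet (M : Set (Set P)) : Prop :=
  LS.IsRelatedSet M ∧ ∀ N, LS.IsRelatedSet N → M ⊆ N → N = M

/-- The star of lines with vertex `A`: all lines through `A`. -/
def star (A : P) : Set (Set P) := {l | l ∈ LS.lines ∧ A ∈ l}

/-- The pencil of planes with axis `a`: all planes containing `a`. -/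
def pencil (a : Set P) : Set (Set P) := {E | LS.IsPlane E ∧ a ⊆ E}

/-- A collineation: a bijection of the point sets mapping each line onto a
line, and whose inverse does likewise. -/
def IsCollineation {P' : Type*} (LS' : LinearSpace P') (κ : P → P') : Prop :=
  Function.Bijective κ ∧ (∀ l ∈ LS.lines, κ '' l ∈ LS'.lines) ∧
    (∀ l' ∈ LS'.lines, κ ⁻¹' l' ∈ LS.lines)

end LinearSpace

namespace LinearSpace

variable {P : Type*} (LS : LinearSpace P)

theorem subset_span (S : Set P) : S ⊆ LS.span S :=
  Set.subset_sInter fun _ hT => hT.2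

theorem isSubspace_span (S : Set P) : LS.IsSubspace (LS.span S) :=
  fun l hl A hAl B hBl hAB hA hB =>
    Set.subset_sInter fun T hT => hT.1 l hl A hAl B hBl hAB (hA T hT) (hB T hT)

variable {LS}

theorem span_subset {S T : Set P} (hT : LS.IsSubspace T) (hST : S ⊆ T) : LS.span S ⊆ T :=
  Set.sInter_subset_of_mem ⟨hT, hST⟩

theorem line_eq {l m : Set P} (hl : l ∈ LS.lines) (hm : m ∈ LS.lines) {A B : P} (hAB : A ≠ B)
    (hAl : A ∈ l) (hBl : B ∈ l) (hAm : A ∈ m) (hBm : B ∈ m) : l = m :=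
  (LS.unique_line A B hAB).unique ⟨hl, hAl, hBl⟩ ⟨hm, hAm, hBm⟩

theorem isSubspace_line {l : Set P} (hl : l ∈ LS.lines) : LS.IsSubspace l :=
  fun _ hm _ hAm _ hBm hAB hAl hBl => (line_eq hm hl hAB hAm hBm hAl hBl).subset

theorem exists_mem_line_ne {l : Set P} (hl : l ∈ LS.lines) (A : P) : ∃ B ∈ l, B ≠ A := by
  obtain ⟨B, C, hBC, hB, hC⟩ := LS.two_points l hl
  by_cases h : B = A
  · exact ⟨C, hC, fun hCA => hBC (h.trans hCA.symm)⟩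
  · exact ⟨B, hB, h⟩

theorem line_eq_of_subset {l m : Set P} (hl : l ∈ LS.lines) (hm : m ∈ LS.lines) (h : l ⊆ m) :
    l = m := by
  obtain ⟨A, B, hAB, hA, hB⟩ := LS.two_points l hl
  exact line_eq hl hm hAB hA hB (h hA) (h hB)

/-- In a linear space with at least one line, any set of at most two points is collinear. -/
theorem exists_line_of_encard_le_two {x : Set P} (hx : x ∈ LS.lines) {X : Set P}
    (hX : X.encard ≤ 2) : ∃ l ∈ LS.lines, X ⊆ l := by
  have key : ∀ A : P, ∃ l ∈ LS.lines, A ∈ l := fun A => by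
    obtain ⟨B, -, hBA⟩ := exists_mem_line_ne hx A
    obtain ⟨l, ⟨hl, -, hA⟩, -⟩ := LS.unique_line B A hBA
    exact ⟨l, hl, hA⟩
  rcases hX.lt_or_eq with h | h
  · have h1 : X.encard ≤ 1 := Order.le_of_lt_add_one (by rwa [one_add_one_eq_two])
    rcases Set.encard_le_one_iff_eq.1 h1 with rfl | ⟨A, rfl⟩
    · exact ⟨x, hx, Set.empty_subset _⟩
    · simpa using key A
  · obtain ⟨A, B, hAB, rfl⟩ := Set.encard_eq_two.1 h
    obtain ⟨l, ⟨hl, hA, hB⟩, -⟩ := LS.unique_line A B hAB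
    exact ⟨l, hl, Set.pair_subset hA hB⟩

theorem isPlane_span_union {x y : Set P} (hx : x ∈ LS.lines) (hy : y ∈ LS.lines) (hxy : x ≠ y)
    (hmeet : (x ∩ y).Nonempty) : LS.IsPlane (LS.span (x ∪ y)) := by
  refine ⟨LS.isSubspace_span _, le_antisymm (sInf_le ?_) (le_sInf ?_)⟩
  · obtain ⟨A, hAx, hAy⟩ := hmeet
    obtain ⟨B, hBx, hBA⟩ := exists_mem_line_ne hx A
    obtain ⟨C, hCy, hCA⟩ := exists_mem_line_ne hy A
    have hBC : B ≠ C := by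
      rintro rfl
      exact hxy (line_eq hx hy hBA hBx hAx hCy hAy)
    have hsub : ({A, B, C} : Set P) ⊆ LS.span (x ∪ y) := by
      refine subset_trans ?_ (LS.subset_span _)
      rintro _ (rfl | rfl | rfl)
      exacts [.inl hAx, .inl hBx, .inr hCy]
    refine ⟨{A, B, C}, hsub, ?_, ?_⟩
    · refine (span_subset (LS.isSubspace_span _) hsub).antisymm
        (span_subset (LS.isSubspace_span _) ?_)
      have hX := LS.subset_span {A, B, C}
      exact Set.union_subset
        (LS.isSubspace_span _ x hx B hBx A hAx hBA (hX (by simp)) (hX (by simp)))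
        (LS.isSubspace_span _ y hy C hCy A hAy hCA (hX (by simp)) (hX (by simp)))
    · rw [Set.encard_eq_three.2 ⟨A, B, C, hBA.symm, hCA.symm, hBC, rfl⟩]
      rfl
  · rintro _ ⟨X, -, hX, rfl⟩
    by_contra! h
    have hcard : X.encard ≤ 2 := by
      by_contra! h3
      have h3' : (3 : ℕ∞) ≤ X.encard := Order.add_one_le_of_lt h3
      exact h.not_ge (tsub_le_tsub_right h3' 1)
    obtain ⟨l, hl, hXl⟩ := exists_line_of_encard_le_two hx hcard
    have hxyl : x ∪ y ⊆ l :=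
      (LS.subset_span _).trans (hX ▸ span_subset (isSubspace_line hl) hXl)
    exact hxy ((line_eq_of_subset hx hl (Set.subset_union_left.trans hxyl)).trans
      (line_eq_of_subset hy hl (Set.subset_union_right.trans hxyl)).symm)

theorem isRelatedSet_star (A : P) : LS.IsRelatedSet (LS.star A) :=
  ⟨fun _ h => h.1, fun _ ha _ hb => ⟨A, ha.2, hb.2⟩⟩

theorem IsMaxRelatedSet.eq_star {M : Set (Set P)} (hM : LS.IsMaxRelatedSet M) {A : P}
    (hA : ∀ l ∈ M, A ∈ l) : M = LS.star A :=
  (hM.2 _ (isRelatedSet_star A) fun l hl => ⟨hM.1.1 hl, hA l hl⟩).symm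

/-- A line meeting two lines through `A`, but not passing through `A`, lies in their join. -/
theorem line_subset_span_union {x y z : Set P} (hx : x ∈ LS.lines) (hy : y ∈ LS.lines)
    (hz : z ∈ LS.lines) (hxy : x ≠ y) {A : P} (hAx : A ∈ x) (hAy : A ∈ y) (hAz : A ∉ z)
    (hzx : (z ∩ x).Nonempty) (hzy : (z ∩ y).Nonempty) : z ⊆ LS.span (x ∪ y) := by
  obtain ⟨B, hBz, hBx⟩ := hzx
  obtain ⟨C, hCz, hCy⟩ := hzy
  have hBA : B ≠ A := fun h => hAz (h ▸ hBz)
  refine LS.isSubspace_span _ z hz B hBz C hCz ?_ (LS.subset_span _ (.inl hBx))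
    (LS.subset_span _ (.inr hCy))
  rintro rfl
  exact hxy (line_eq hx hy hBA hBx hAx hCy hAy)

theorem IsRelatedSet.span_sUnion_eq {M : Set (Set P)} (hM : LS.IsRelatedSet M)
    (hcommon : ∀ A : P, ∃ l ∈ M, A ∉ l) {x y : Set P} (hx : x ∈ M) (hy : y ∈ M) (hxy : x ≠ y) :
    LS.span (⋃₀ M) = LS.span (x ∪ y) := by
  refine (span_subset (LS.isSubspace_span _) (Set.sUnion_subset fun w hw => ?_)).antisymm
    (span_subset (LS.isSubspace_span _) (subset_trans
      (Set.union_subset (Set.subset_sUnion_of_mem hx) (Set.subset_sUnion_of_mem hy))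
      (LS.subset_span _)))
  obtain ⟨A, hAx, hAy⟩ := hM.2 x hx y hy
  have key : ∀ z ∈ M, A ∉ z → z ⊆ LS.span (x ∪ y) := fun z hz hAz =>
    line_subset_span_union (hM.1 hx) (hM.1 hy) (hM.1 hz) hxy hAx hAy hAz
      (hM.2 z hz x hx) (hM.2 z hz y hy)
  by_cases hAw : A ∈ w
  · obtain ⟨z, hz, hAz⟩ := hcommon A
    obtain ⟨B, hBw, hBz⟩ := hM.2 w hw z hz
    exact LS.isSubspace_span _ w (hM.1 hw) A hAw B hBw (fun h => hAz (h ▸ hBz))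
      (LS.subset_span _ (.inl hAx)) (key z hz hAz hBz)
  · exact key w hw hAw

theorem nonempty_of_dim_pos (h : 0 < LS.dim) : Nonempty P := by
  by_contra hP
  rw [not_nonempty_iff] at hP
  refine h.not_ge (sInf_le ⟨∅, Set.empty_subset _, ?_, by simp⟩)
  exact Subsingleton.elim _ _

end LinearSpace

/-- If `dim (P, L) ≥ 3`, every maximal related set is either a star of lines
or coplanar: the union of its lines spans a plane `E` with `E = x ∨ y` for
all distinct `x, y ∈ M`. -/
theorem maxRelatedSet_star_or_coplanar
    {P : Type*} (LS : LinearSpace P) (hdim : 3 ≤ LS.dim)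
    (M : Set (Set P)) (hM : LS.IsMaxRelatedSet M) :
    (∃ A : P, M = LS.star A) ∨
    (LS.IsPlane (LS.span (⋃₀ M)) ∧
      ∀ x ∈ M, ∀ y ∈ M, x ≠ y → LS.span (⋃₀ M) = LS.span (x ∪ y)) := by
  by_cases h : ∃ A : P, ∀ l ∈ M, A ∈ l
  · exact .inl (h.imp fun _ hA => hM.eq_star hA)
  push Not at h
  refine .inr ⟨?_, fun x hx y hy => hM.1.span_sUnion_eq h hx hy⟩
  obtain ⟨A⟩ := LinearSpace.nonempty_of_dim_pos (lt_of_lt_of_le (by norm_num) hdim)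
  obtain ⟨x, hx, -⟩ := h A
  obtain ⟨B, -, -, hB, -⟩ := LS.two_points x (hM.1.1 hx)
  obtain ⟨y, hy, hBy⟩ := h B
  have hxy : x ≠ y := fun e => hBy (e ▸ hB)
  rw [hM.1.span_sUnion_eq h hx hy hxy]
  exact LinearSpace.isPlane_span_union (hM.1.1 hx) (hM.1.1 hy) hxy (hM.1.2 x hx y hy)
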